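/- Let 𝒜 be a minimally self-adjusting BST algorithm. Suppose the after-trees created by 𝒜 cannot be decomposed into a bounded number of monotone sets: for every k there is an access performed by 𝒜 whose after-tree minus its root cannot be partitioned into k monotone sets. Then 𝒜 does not satisfy the access lemma via the SOL potential; that is, for every constant C there exist an access performed by 𝒜 (tree T, accessed element s, search path P, resulting tree T') and a positive weight function w such that |P| > Φ_T − Φ_{T'} + C·(1 + log(W/w(s))). -/

import Mathlib

namespace Paper

inductive BTree where
  | nil : BTree
  | node : BTree → ℕ → BTree → BTree
deriving DecidableEq

namespace BTree

def keys : BTree → Finset ℕ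
  | nil => ∅
  | node l x r => insert x (keys l ∪ keys r)

def root? : BTree → Option ℕ
  | nil => none
  | node _ x _ => some x

def isBST : BTree → Prop
  | nil => True
  | node l x r => (∀ y ∈ keys l, y < x) ∧ (∀ y ∈ keys r, x < y) ∧ isBST l ∧ isBST r

def subtree? (s : ℕ) : BTree → Option BTree
  | nil => none
  | node l x r => if s = x then some (node l x r) else if s < x then subtree? s l else subtree? s r

/-- The set of keys of the subtree rooted at `s` (∅ if `s` is not in the tree). -/
def subtreeKeys (T : BTree) (s : ℕ) : Finset ℕ := ((subtree? s T).map keys).getD ∅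

/-- The search path to `s`, listed from the root downwards. -/
def pathList (s : ℕ) : BTree → List ℕ
  | nil => []
  | node l x r => if s = x then [x] else if s < x then x :: pathList s l else x :: pathList s r

def pathSet (T : BTree) (s : ℕ) : Finset ℕ := (pathList s T).toFinset

def nodeDepth (s : ℕ) : BTree → ℕ
  | nil => 0
  | node l x r => if s = x then 0 else if s < x then nodeDepth s l + 1 else nodeDepth s r + 1

/-- Number of right-going edges on the path from the root to `s`. -/
def rightDepth (s : ℕ) : BTree → ℕ
  | nil => 0
  | node l x r => if s = x then 0 else if s < x then rightDepth s l else rightDepth s r + 1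

/-- Number of left-going edges on the path from the root to `s`. -/
def leftDepth (s : ℕ) : BTree → ℕ
  | nil => 0
  | node l x r => if s = x then 0 else if s < x then leftDepth s l + 1 else leftDepth s r

def leafCount : BTree → ℕ
  | nil => 0
  | node nil _ nil => 1
  | node l _ r => leafCount l + leafCount r

/-- The wing partition of a BST, each wing listed from its topmost node downwards. -/
def wings : BTree → List (List ℕ)
  | nil => []
  | node l x r =>
    match wings l with
    | [] => [x] :: wings r
    | wl :: rest => (x :: wl) :: (rest ++ wings r)

end BTree

open BTree

/-- The left-leaning path on `[n]`: `n` at the root, `1` at the deepest node. -/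
def leftPathTree : ℕ → BTree
  | 0 => BTree.nil
  | n + 1 => BTree.node (leftPathTree n) (n + 1) BTree.nil

/-- Number of side alternations (w.r.t. `s`) between adjacent elements of a list. -/
def sideAlt (s : ℕ) : List ℕ → ℕ
  | x :: y :: rest => (if (x < s ∧ s < y) ∨ (y < s ∧ s < x) then 1 else 0) + sideAlt s (y :: rest)
  | _ => 0

/-- The set of elements involved in side alternations (w.r.t. `s`) in a list. -/
def zigzagSet (s : ℕ) : List ℕ → Finset ℕ
  | x :: y :: rest =>
    (if (x < s ∧ s < y) ∨ (y < s ∧ s < x) then ({x, y} : Finset ℕ) else ∅) ∪ zigzagSet s (y :: rest)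
  | _ => ∅

noncomputable def wsum (w : ℕ → ℝ) (X : Finset ℕ) : ℝ := ∑ b ∈ X, w b

/-- Partial sum-of-logs potential of the set `X` in tree `T` (binary logarithm). -/
noncomputable def phiOn (w : ℕ → ℝ) (T : BTree) (X : Finset ℕ) : ℝ :=
  ∑ a ∈ X, Real.logb 2 (wsum w (subtreeKeys T a))

noncomputable def phiAll (w : ℕ → ℝ) (T : BTree) : ℝ := phiOn w T (keys T)

/-- A single access of a minimally self-adjusting BST algorithm: the accessed element `s`
becomes the root, the keys are unchanged, and every node off the search path keeps its
subtree; hence the search path is replaced by an after-tree rooted at `s` and the pendent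
subtrees are reattached in the unique order-preserving way. -/
structure IsAccess (T : BTree) (s : ℕ) (T' : BTree) : Prop where
  hT : isBST T
  hT' : isBST T'
  hs : s ∈ keys T
  hkeys : keys T' = keys T
  hroot : root? T' = some s
  hpendent : ∀ a ∈ keys T, a ∉ pathSet T s → subtree? a T' = subtree? a T

/-- The algorithm (viewed as the set of accesses it may perform) satisfies the access lemma
via the sum-of-logs potential. -/
def SatisfiesAL (Alg : BTree → ℕ → BTree → Prop) : Prop :=
  ∃ C : ℝ, 0 ≤ C ∧ ∀ T s T', Alg T s T' → ∀ w : ℕ → ℝ, (∀ i ∈ keys T, 0 < w i) →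
    ((pathSet T s).card : ℝ) ≤
      phiAll w T - phiAll w T' + C * (1 + Real.logb 2 (wsum w (keys T) / w s))

/-- `X` is subtree-disjoint (w.r.t. the tree after the access). -/
def SubtreeDisjoint (T' : BTree) (X : Finset ℕ) : Prop :=
  ∀ a ∈ X, ∀ b ∈ X, a ≠ b → subtreeKeys T' a ∩ subtreeKeys T' b = ∅

/-- `X` is monotone: all elements on one side of `s`, with equal right-depth
(resp. left-depth) in the after-tree.  (For nodes of the search path, depth in the
after-tree coincides with depth in `T'`.) -/
def IsMonotone (s : ℕ) (T' : BTree) (X : Finset ℕ) : Prop :=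
  ((∀ x ∈ X, s < x) ∧ ∃ d, ∀ x ∈ X, rightDepth x T' = d) ∨
  ((∀ x ∈ X, x < s) ∧ ∃ d, ∀ x ∈ X, leftDepth x T' = d)

/-- The after-tree minus its root can be partitioned into (at most) `k` monotone sets. -/
def MonotoneDecomp (T : BTree) (s : ℕ) (T' : BTree) (k : ℕ) : Prop :=
  ∃ M : Fin k → Finset ℕ,
    (∀ i, IsMonotone s T' (M i)) ∧
    (∀ i j, i ≠ j → Disjoint (M i) (M j)) ∧
    Finset.univ.biUnion M = pathSet T s \ {s}

/-- The leaves of the after-tree: path nodes having no path node as proper descendant in `T'`. -/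
def afterLeaves (T : BTree) (s : ℕ) (T' : BTree) : Finset ℕ :=
  (pathSet T s).filter (fun x => subtreeKeys T' x ∩ pathSet T s = {x})

/-- Rotate-to-root: `s` becomes the root and ancestor relations are otherwise preserved,
equivalently `T'(a) = T(a) ∩ (-∞,s)` for path nodes `a < s` and symmetrically for `a > s`. -/
def IsRotateToRoot (T : BTree) (s : ℕ) (T' : BTree) : Prop :=
  subtreeKeys T' s = keys T ∧
  ∀ a ∈ pathSet T s,
    (a < s → subtreeKeys T' a = (subtreeKeys T a).filter (fun b => b < s)) ∧
    (s < a → subtreeKeys T' a = (subtreeKeys T a).filter (fun b => s < b))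

def pendTree : Option ℕ → BTree
  | none => BTree.nil
  | some u => BTree.node BTree.nil u BTree.nil

def buildLeft (l : List (ℕ × Option ℕ)) : BTree :=
  l.foldl (fun t vc => BTree.node (pendTree vc.2) vc.1 t) BTree.nil

def buildRight (l : List (ℕ × Option ℕ)) : BTree :=
  l.foldl (fun t vc => BTree.node t vc.1 (pendTree vc.2)) BTree.nil

/-- Global view of splay: process the reversed search path `v₁, v₂, …` in pairs; if a pair
lies on the same side of `s`, the more ancestral element is removed from its path and
becomes a (pendant) child of the other.  Returns the two spines (elements `< s` and `> s`),
deepest first, each spine node with its optional pendant child. -/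
def splaySpines (s : ℕ) : List ℕ → List (ℕ × Option ℕ) × List (ℕ × Option ℕ)
  | [] => ([], [])
  | [v] => if v < s then ([(v, none)], []) else ([], [(v, none)])
  | v :: u :: rest =>
    let p := splaySpines s rest
    if v < s then
      if u < s then ((v, some u) :: p.1, p.2)
      else ((v, none) :: p.1, (u, none) :: p.2)
    else
      if u < s then ((u, none) :: p.1, (v, none) :: p.2)
      else (p.1, (v, some u) :: p.2)

/-- The after-tree of a splay access, built from the reversed search path without `s`. -/
def splayAfterTree (s : ℕ) (l : List ℕ) : BTree :=
  BTree.node (buildLeft (splaySpines s l).1) s (buildRight (splaySpines s l).2)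

/-- A splay access: a valid access whose after-tree (the restriction of `T'` to the search
path) is the splay after-tree. -/
def IsSplayAccess (T : BTree) (s : ℕ) (T' : BTree) : Prop :=
  IsAccess T s T' ∧
  ∀ x ∈ pathSet T s,
    subtreeKeys T' x ∩ pathSet T s = subtreeKeys (splayAfterTree s (pathList s T).reverse.tail) x

/-- A path-balance access: a valid access whose after-tree is a balanced BST of depth
`⌈log₂ (1 + |P|)⌉` rooted at `s`. -/
def IsPathBalanceAccess (T : BTree) (s : ℕ) (T' : BTree) : Prop :=
  IsAccess T s T' ∧
  ∀ x ∈ pathSet T s, nodeDepth x T' ≤ Nat.clog 2 (1 + (pathSet T s).card)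

def isParent (Q : BTree) (x y : ℕ) : Prop := pathList y Q = pathList x Q ++ [y]

/-- One step of a decomposition: a (descending) path `Pi` of `Q` is rearranged into a tree,
all other nodes keeping their subtrees. -/
def StepRel (Q Q' : BTree) (Pi : Finset ℕ) : Prop :=
  isBST Q' ∧ keys Q' = keys Q ∧
  (∃ l : List ℕ, l ≠ [] ∧ List.Chain' (isParent Q) l ∧ l.toFinset = Pi) ∧
  (∀ a ∈ keys Q, a ∉ Pi → subtree? a Q' = subtree? a Q)

/-- The transformation of the before-path `P0` (as a tree) into the after-tree `A` admits a
local decomposition with window size `wdw`. -/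
def HasLocalDecomp (s : ℕ) (P0 A : BTree) (wdw : ℕ) : Prop :=
  ∃ (k : ℕ) (Q : ℕ → BTree) (Ps : ℕ → Finset ℕ),
    1 ≤ k ∧ Q 0 = P0 ∧ Q k = A ∧
    (∀ i < k, StepRel (Q i) (Q (i + 1)) (Ps i)) ∧
    s ∈ Ps 0 ∧
    (∀ i, i + 1 < k → (Ps (i + 1) \ Ps i).Nonempty) ∧
    (∀ i, i + 1 < k → (Ps (i + 1) ∩ Ps i).Nonempty) ∧
    (∀ i j, i + 1 < j → j < k → Disjoint (Ps i \ Ps (i + 1)) (Ps j)) ∧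
    (∀ i < k, (Ps i).card ≤ wdw)

/-- The search path to `s` in `T`, as a tree (the before-path of the transformation). -/
def pathTree (s : ℕ) : BTree → BTree
  | BTree.nil => BTree.nil
  | BTree.node l x r =>
    if s = x then BTree.node BTree.nil x BTree.nil
    else if s < x then BTree.node (pathTree s l) x BTree.nil
    else BTree.node BTree.nil x (pathTree s r)

/-- `A` is the after-tree of the access `(T, s, T')`: the restriction of `T'` to the search path. -/
def IsAfterTree (T : BTree) (s : ℕ) (T' A : BTree) : Prop :=
  isBST A ∧ keys A = pathSet T s ∧
  ∀ x ∈ pathSet T s, subtreeKeys A x = subtreeKeys T' x ∩ pathSet T s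

/-- The algorithm is local with window size `wdw`. -/
def IsLocal (Alg : BTree → ℕ → BTree → Prop) (wdw : ℕ) : Prop :=
  ∀ T s T', Alg T s T' → ∀ A, IsAfterTree T s T' A → HasLocalDecomp s (pathTree s T) A wdw

open scoped Classical in
noncomputable def stair (n : ℕ) (h : ℕ → ℕ) (s : ℕ) : Finset ℕ :=
  (Finset.Icc 1 n).filter
    (fun b => ∀ b' ∈ Finset.Icc 1 n, ((s < b' ∧ b' < b) ∨ (b < b' ∧ b' < s)) → h b' < h b)

open scoped Classical in
noncomputable def nbhd (n : ℕ) (h : ℕ → ℕ) (a : ℕ) : Finset ℕ :=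
  (Finset.Icc 1 n).filter
    (fun b => ∀ b' ∈ Finset.Icc 1 n, b' ≠ a → min a b ≤ b' → b' ≤ max a b → h b' < h a)

/-- Geometric sum-of-logs partial potential. -/
noncomputable def phiGeo (n : ℕ) (h : ℕ → ℕ) (w : ℕ → ℝ) (X : Finset ℕ) : ℝ :=
  ∑ a ∈ X, Real.logb 2 (wsum w (nbhd n h a))

/-- `l` is (the reversal of) a valid search path to `s`, without `s`, deepest element first. -/
def ValidRevPath (s : ℕ) (l : List ℕ) : Prop :=
  l.Nodup ∧ s ∉ l ∧
  l.Pairwise (fun a b => (a < s → b < s → b < a) ∧ (s < a → s < b → a < b))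

end Paper

open Paper Paper.BTree

namespace Paper

namespace BTree

theorem subtreeKeys_nil (a : ℕ) : subtreeKeys nil a = ∅ := rfl

theorem mem_keys_node {l r : BTree} {x a : ℕ} :
    a ∈ keys (node l x r) ↔ a = x ∨ a ∈ keys l ∨ a ∈ keys r := by
  simp [keys]

theorem mem_subtreeKeys_node {l r : BTree} {x y a : ℕ} :
    y ∈ subtreeKeys (node l x r) a ↔
      (a = x ∧ (y = x ∨ y ∈ keys l ∨ y ∈ keys r)) ∨
        (a < x ∧ y ∈ subtreeKeys l a) ∨ (x < a ∧ y ∈ subtreeKeys r a) := by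
  rw [← mem_keys_node]
  unfold subtreeKeys
  simp only [subtree?]
  split_ifs
  · simp only [Option.map_some, Option.getD_some]
    grind
  all_goals grind

theorem subtreeKeys_subset (T : BTree) (a : ℕ) : subtreeKeys T a ⊆ keys T := by
  induction T with
  | nil => simp [subtreeKeys_nil]
  | node l x r ihl ihr =>
    intro y hy
    simp only [mem_subtreeKeys_node, mem_keys_node] at *
    grind

theorem self_mem_subtreeKeys {T : BTree} (hT : isBST T) {a : ℕ} (ha : a ∈ keys T) :
    a ∈ subtreeKeys T a := by
  induction T with
  | nil => simp [keys] at ha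
  | node l x r ihl ihr =>
    obtain ⟨h1, h2, h3, h4⟩ := hT
    simp only [mem_subtreeKeys_node, mem_keys_node] at *
    grind

theorem mem_subtreeKeys_of_between {T : BTree} (hT : isBST T) {x y b : ℕ}
    (hx : x ∈ subtreeKeys T b) (hy : y ∈ keys T)
    (hxy : (x ≤ y ∧ y ≤ b) ∨ (b ≤ y ∧ y ≤ x)) : y ∈ subtreeKeys T b := by
  induction T with
  | nil => simp [keys] at hy
  | node l z r ihl ihr =>
    obtain ⟨h1, h2, h3, h4⟩ := hT
    have hl := subtreeKeys_subset l b
    have hr := subtreeKeys_subset r b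
    simp only [mem_subtreeKeys_node, mem_keys_node] at *
    grind

theorem subtreeKeys_left_closed {T : BTree} (hT : isBST T) {a b c : ℕ}
    (ha : a ∈ subtreeKeys T b) (hab : a < b) (hc : c ∈ subtreeKeys T a) :
    c ∈ subtreeKeys T b ∧ c < b := by
  induction T with
  | nil => simp [subtreeKeys_nil] at ha
  | node l z r ihl ihr =>
    obtain ⟨h1, h2, h3, h4⟩ := hT
    have hl := subtreeKeys_subset l a
    have hr := subtreeKeys_subset r a
    have hl' := subtreeKeys_subset l b
    have hr' := subtreeKeys_subset r b
    simp only [mem_subtreeKeys_node] at *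
    grind

theorem subtreeKeys_right_closed {T : BTree} (hT : isBST T) {a b c : ℕ}
    (ha : a ∈ subtreeKeys T b) (hab : b < a) (hc : c ∈ subtreeKeys T a) :
    c ∈ subtreeKeys T b ∧ b < c := by
  induction T with
  | nil => simp [subtreeKeys_nil] at ha
  | node l z r ihl ihr =>
    obtain ⟨h1, h2, h3, h4⟩ := hT
    have hl := subtreeKeys_subset l a
    have hr := subtreeKeys_subset r a
    have hl' := subtreeKeys_subset l b
    have hr' := subtreeKeys_subset r b
    simp only [mem_subtreeKeys_node] at *
    grind

theorem mem_pathSet_node {l r : BTree} {x s b : ℕ} :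
    b ∈ pathSet (node l x r) s ↔
      b = x ∨ (s < x ∧ b ∈ pathSet l s) ∨ (x < s ∧ b ∈ pathSet r s) := by
  simp only [pathSet, pathList, List.mem_toFinset]
  split_ifs <;> simp <;> grind

theorem mem_keys_of_mem_pathSet {T : BTree} {s b : ℕ} (hb : b ∈ pathSet T s) : b ∈ keys T := by
  induction T with
  | nil => simp [pathSet, pathList] at hb
  | node l x r ihl ihr =>
    rw [mem_pathSet_node] at hb
    rw [mem_keys_node]
    grind

theorem mem_subtreeKeys_of_mem_pathSet {T : BTree} (hT : isBST T) {s b : ℕ} (hs : s ∈ keys T)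
    (hb : b ∈ pathSet T s) : s ∈ subtreeKeys T b := by
  induction T with
  | nil => simp [pathSet, pathList] at hb
  | node l x r ihl ihr =>
    obtain ⟨h1, h2, h3, h4⟩ := hT
    have hl := @mem_keys_of_mem_pathSet l s b
    have hr := @mem_keys_of_mem_pathSet r s b
    rw [mem_pathSet_node] at hb
    simp only [mem_subtreeKeys_node, mem_keys_node] at *
    grind

theorem pathSet_card_pos {T : BTree} {s : ℕ} (hs : s ∈ keys T) : 0 < (pathSet T s).card := by
  cases T with
  | nil => simp [keys] at hs
  | node l x r => exact Finset.card_pos.mpr ⟨x, mem_pathSet_node.mpr (Or.inl rfl)⟩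

theorem rightDepth_le_card {T : BTree} (hT : isBST T) {b : ℕ} (hb : b ∈ keys T) :
    rightDepth b T ≤ ((keys T).filter fun a => a < b ∧ b ∈ subtreeKeys T a).card := by
  induction T with
  | nil => simp [keys] at hb
  | node l x r ihl ihr =>
    obtain ⟨h1, h2, h3, h4⟩ := hT
    simp only [rightDepth]
    have hb' := mem_keys_node.mp hb
    split_ifs with hbx hlt
    · simp
    · refine (ihl h3 (by grind)).trans (Finset.card_le_card fun a ha => ?_)
      simp only [Finset.mem_filter, mem_subtreeKeys_node, mem_keys_node] at *
      grind
    · refine (Nat.succ_le_succ (ihr h4 (by grind))).trans ?_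
      rw [Nat.succ_eq_add_one, ← Finset.card_insert_of_notMem (a := x)
        (by simp only [Finset.mem_filter]; grind)]
      refine Finset.card_le_card fun a ha => ?_
      simp only [Finset.mem_insert, Finset.mem_filter, mem_subtreeKeys_node, mem_keys_node] at *
      grind

theorem leftDepth_le_card {T : BTree} (hT : isBST T) {b : ℕ} (hb : b ∈ keys T) :
    leftDepth b T ≤ ((keys T).filter fun a => b < a ∧ b ∈ subtreeKeys T a).card := by
  induction T with
  | nil => simp [keys] at hb
  | node l x r ihl ihr =>
    obtain ⟨h1, h2, h3, h4⟩ := hT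
    simp only [leftDepth]
    have hb' := mem_keys_node.mp hb
    split_ifs with hbx hlt
    · simp
    · refine (Nat.succ_le_succ (ihl h3 (by grind))).trans ?_
      rw [Nat.succ_eq_add_one, ← Finset.card_insert_of_notMem (a := x)
        (by simp only [Finset.mem_filter]; grind)]
      refine Finset.card_le_card fun a ha => ?_
      simp only [Finset.mem_insert, Finset.mem_filter, mem_subtreeKeys_node, mem_keys_node] at *
      grind
    · refine (ihr h4 (by grind)).trans (Finset.card_le_card fun a ha => ?_)
      simp only [Finset.mem_filter, mem_subtreeKeys_node, mem_keys_node] at *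
      grind

end BTree

open BTree

theorem IsAccess.exists_node {T T' : BTree} {s : ℕ} (h : IsAccess T s T') :
    ∃ l r, T' = node l s r := by
  have hroot := h.hroot
  cases T' with
  | nil => simp [root?] at hroot
  | node l x r =>
    simp only [root?, Option.some.injEq] at hroot
    exact ⟨l, r, by rw [hroot]⟩

/-- Put a tiny weight on a set `L` that is closed under descendants in `T` and contains `s`, and
weight one elsewhere. Each node of `L` having a descendant outside `L` in `T'` then
gains as much potential as the term `log (W / w s)` costs. -/
theorem exists_weight_of_closed {T T' : BTree} {s b : ℕ} (h : IsAccess T s T') (C : ℝ)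
    (L B : Finset ℕ) (hsL : s ∈ L) (hb : b ∈ keys T) (hbL : b ∉ L)
    (hclosed : ∀ a ∈ L, subtreeKeys T a ⊆ L) (hBL : B ⊆ L) (hBT : B ⊆ keys T)
    (hB : ∀ a ∈ B, b ∈ subtreeKeys T' a) (hcard : |C| + 1 ≤ (B.card : ℝ)) :
    ∃ w : ℕ → ℝ, (∀ i ∈ keys T, 0 < w i) ∧
      phiAll w T - phiAll w T' + C * (1 + Real.logb 2 (wsum w (keys T) / w s)) <
        ((pathSet T s).card : ℝ) := by
  classical
  set n : ℝ := ((keys T).card : ℝ) with hn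
  have hn1 : 1 ≤ n := by
    rw [hn]; exact_mod_cast Finset.card_pos.mpr ⟨b, hb⟩
  have hlogn : 0 ≤ Real.logb 2 n := Real.logb_nonneg (by norm_num) hn1
  set G : ℝ := n * Real.logb 2 n + |C| * (1 + Real.logb 2 n) with hG
  have hG0 : 0 ≤ G := by positivity
  set ε : ℝ := (2 : ℝ) ^ (-G) with hε
  have hε0 : 0 < ε := by positivity
  have hε1 : ε ≤ 1 := Real.rpow_le_one_of_one_le_of_nonpos (by norm_num) (by linarith)
  have hlogε : Real.logb 2 ε = -G := by
    rw [hε, Real.logb_rpow (by norm_num) (by norm_num)]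
  set w : ℕ → ℝ := fun x => if x ∈ L then ε else 1 with hw
  have hwpos : ∀ x, 0 < w x := fun x => by simp only [hw]; split_ifs <;> positivity
  have hwle : ∀ x, w x ≤ 1 := fun x => by simp only [hw]; split_ifs <;> linarith
  have hwb : w b = 1 := by simp [hw, hbL]
  have hws : w s = ε := by simp [hw, hsL]
  have hmem : ∀ (X : Finset ℕ) (a : ℕ), a ∈ X → w a ≤ wsum w X := fun X a ha =>
    Finset.single_le_sum (f := w) (fun i _ => (hwpos i).le) ha
  have hcardle : ∀ X ⊆ keys T, ∀ c : ℝ, 0 ≤ c → (∀ x ∈ X, w x ≤ c) → wsum w X ≤ n * c := by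
    intro X hX c hc hxc
    refine (Finset.sum_le_card_nsmul X w c hxc).trans ?_
    rw [nsmul_eq_mul]
    gcongr
    rw [hn]
    exact_mod_cast Finset.card_le_card hX
  have hTle : ∀ a, wsum w (subtreeKeys T a) ≤ n * w a := by
    intro a
    refine hcardle _ (subtreeKeys_subset T a) _ (hwpos a).le fun x hx => ?_
    by_cases haL : a ∈ L
    · simp [hw, haL, hclosed a haL hx]
    · simpa [hw, haL] using hwle x
  have hterm : ∀ a ∈ keys T, Real.logb 2 (wsum w (subtreeKeys T a)) -
      Real.logb 2 (wsum w (subtreeKeys T' a)) ≤ Real.logb 2 n - (if a ∈ B then G else 0) := by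
    intro a ha
    have hself := hmem _ a (self_mem_subtreeKeys h.hT ha)
    have hself' := hmem _ a (self_mem_subtreeKeys h.hT' (h.hkeys ▸ ha))
    have hup : Real.logb 2 (wsum w (subtreeKeys T a)) ≤ Real.logb 2 n + Real.logb 2 (w a) := by
      rw [← Real.logb_mul (zero_lt_one.trans_le hn1).ne' (hwpos a).ne']
      exact Real.logb_le_logb_of_le (by norm_num) ((hwpos a).trans_le hself) (hTle a)
    split_ifs with haB
    · have hwa : w a = ε := if_pos (hBL haB)
      have hlow : 0 ≤ Real.logb 2 (wsum w (subtreeKeys T' a)) :=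
        Real.logb_nonneg (by norm_num) (hwb.symm.trans_le (hmem _ b (hB a haB)))
      rw [hwa, hlogε] at hup
      linarith
    · have hlow := Real.logb_le_logb_of_le (b := 2) (by norm_num) (hwpos a) hself'
      linarith
  have hphi : phiAll w T - phiAll w T' ≤ n * Real.logb 2 n - B.card * G := by
    unfold phiAll phiOn
    rw [h.hkeys, ← Finset.sum_sub_distrib]
    refine (Finset.sum_le_sum hterm).trans_eq ?_
    rw [Finset.sum_sub_distrib, Finset.sum_ite_mem, Finset.inter_eq_right.mpr hBT]
    simp [hn]
  have hW0 : 0 ≤ Real.logb 2 (wsum w (keys T) / w s) :=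
    Real.logb_nonneg (by norm_num) ((one_le_div (hwpos s)).mpr (hmem _ s h.hs))
  have hW : Real.logb 2 (wsum w (keys T) / w s) ≤ Real.logb 2 n + G := by
    have hpos : 0 < wsum w (keys T) := (hwpos s).trans_le (hmem _ s h.hs)
    have hle := hcardle (keys T) subset_rfl 1 zero_le_one fun x _ => hwle x
    rw [Real.logb_div hpos.ne' (hwpos s).ne', hws, hlogε, sub_neg_eq_add]
    gcongr
    · norm_num
    · linarith
  have hCW : C * (1 + Real.logb 2 (wsum w (keys T) / w s)) ≤ |C| * (1 + (Real.logb 2 n + G)) :=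
    mul_le_mul (le_abs_self C) (by linarith) (by linarith) (abs_nonneg C)
  have hP : (0 : ℝ) < (pathSet T s).card := by exact_mod_cast pathSet_card_pos h.hs
  have hBG : (|C| + 1) * G ≤ B.card * G := mul_le_mul_of_nonneg_right hcard hG0
  exact ⟨w, fun i _ => hwpos i, by nlinarith⟩

theorem exists_weight_of_rightDepth {T T' : BTree} {s b : ℕ} (h : IsAccess T s T') (C : ℝ)
    (hb : b ∈ pathSet T s) (hsb : s < b) (hdepth : |C| + 2 ≤ (rightDepth b T' : ℝ)) :
    ∃ w : ℕ → ℝ, (∀ i ∈ keys T, 0 < w i) ∧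
      phiAll w T - phiAll w T' + C * (1 + Real.logb 2 (wsum w (keys T) / w s)) <
        ((pathSet T s).card : ℝ) := by
  obtain ⟨l, r, rfl⟩ := h.exists_node
  obtain ⟨hl, hr, -, hrT⟩ := h.hT'
  have hbT := mem_keys_of_mem_pathSet hb
  have hsT := mem_subtreeKeys_of_mem_pathSet h.hT h.hs hb
  have hrsub : keys r ⊆ keys T := fun a ha => by
    rw [← h.hkeys, mem_keys_node]; exact Or.inr (Or.inr ha)
  have hbr : b ∈ keys r := by
    have hb' := hbT
    rw [← h.hkeys, mem_keys_node] at hb'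
    grind
  refine exists_weight_of_closed h C ((subtreeKeys T b).filter (· < b))
    ((keys r).filter fun a => a < b ∧ b ∈ subtreeKeys r a) (by simp [hsT, hsb]) hbT (by simp)
    ?_ ?_ ((Finset.filter_subset _ _).trans hrsub) ?_ ?_
  · intro a ha c hc
    rw [Finset.mem_filter] at *
    exact subtreeKeys_left_closed h.hT ha.1 ha.2 hc
  · intro a ha
    rw [Finset.mem_filter] at *
    exact ⟨mem_subtreeKeys_of_between h.hT hsT (hrsub ha.1)
      (Or.inl ⟨(hr a ha.1).le, ha.2.1.le⟩), ha.2.1⟩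
  · intro a ha
    rw [Finset.mem_filter] at ha
    have hsa := hr a ha.1
    grind [mem_subtreeKeys_node]
  · have hle := rightDepth_le_card hrT hbr
    rw [rightDepth, if_neg hsb.ne', if_neg hsb.not_gt] at hdepth
    push_cast at hdepth
    have hle' : (rightDepth b r : ℝ) ≤ _ := Nat.cast_le.mpr hle
    linarith

theorem exists_weight_of_leftDepth {T T' : BTree} {s b : ℕ} (h : IsAccess T s T') (C : ℝ)
    (hb : b ∈ pathSet T s) (hbs : b < s) (hdepth : |C| + 2 ≤ (leftDepth b T' : ℝ)) :
    ∃ w : ℕ → ℝ, (∀ i ∈ keys T, 0 < w i) ∧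
      phiAll w T - phiAll w T' + C * (1 + Real.logb 2 (wsum w (keys T) / w s)) <
        ((pathSet T s).card : ℝ) := by
  obtain ⟨l, r, rfl⟩ := h.exists_node
  obtain ⟨hl, hr, hlT, -⟩ := h.hT'
  have hbT := mem_keys_of_mem_pathSet hb
  have hsT := mem_subtreeKeys_of_mem_pathSet h.hT h.hs hb
  have hlsub : keys l ⊆ keys T := fun a ha => by
    rw [← h.hkeys, mem_keys_node]; exact Or.inr (Or.inl ha)
  have hbl : b ∈ keys l := by
    have hb' := hbT
    rw [← h.hkeys, mem_keys_node] at hb'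
    grind
  refine exists_weight_of_closed h C ((subtreeKeys T b).filter (b < ·))
    ((keys l).filter fun a => b < a ∧ b ∈ subtreeKeys l a) (by simp [hsT, hbs]) hbT (by simp)
    ?_ ?_ ((Finset.filter_subset _ _).trans hlsub) ?_ ?_
  · intro a ha c hc
    rw [Finset.mem_filter] at *
    exact subtreeKeys_right_closed h.hT ha.1 ha.2 hc
  · intro a ha
    rw [Finset.mem_filter] at *
    exact ⟨mem_subtreeKeys_of_between h.hT hsT (hlsub ha.1)
      (Or.inr ⟨ha.2.1.le, (hl a ha.1).le⟩), ha.2.1⟩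
  · intro a ha
    rw [Finset.mem_filter] at ha
    have hsa := hl a ha.1
    grind [mem_subtreeKeys_node]
  · have hle := leftDepth_le_card hlT hbl
    rw [leftDepth, if_neg hbs.ne, if_pos hbs] at hdepth
    push_cast at hdepth
    have hle' : (leftDepth b l : ℝ) ≤ _ := Nat.cast_le.mpr hle
    linarith

theorem monotoneDecomp_of_depth_lt {T T' : BTree} {s K : ℕ}
    (hright : ∀ b ∈ pathSet T s, s < b → rightDepth b T' < K)
    (hleft : ∀ b ∈ pathSet T s, b < s → leftDepth b T' < K) :
    MonotoneDecomp T s T' (K + K) := by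
  refine ⟨fun i => if i.val < K then
      (pathSet T s).filter fun b => s < b ∧ rightDepth b T' = i.val
    else (pathSet T s).filter fun b => b < s ∧ K + leftDepth b T' = i.val, ?_, ?_, ?_⟩
  · intro i
    dsimp only
    split_ifs
    · exact Or.inl ⟨by simp +contextual, i.val, by simp +contextual⟩
    · exact Or.inr ⟨by simp +contextual, i.val - K, by grind⟩
  · intro i j hij
    have hij' : i.val ≠ j.val := Fin.val_ne_of_ne hij
    rw [Finset.disjoint_left]
    grind
  · ext b
    simp only [Finset.mem_biUnion, Finset.mem_univ, true_and, Finset.mem_sdiff,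
      Finset.mem_singleton]
    constructor
    · rintro ⟨i, hi⟩
      grind
    · rintro ⟨hb, hbs⟩
      rcases lt_or_gt_of_ne hbs with hlt | hgt
      · have hd := hleft b hb hlt
        exact ⟨⟨K + leftDepth b T', by omega⟩, by simp [hb, hlt]⟩
      · have hd := hright b hb hgt
        exact ⟨⟨rightDepth b T', by omega⟩, by simp [hb, hgt, hd]⟩

end Paper

/-- **Theorem (necessity of O(1) monotone sets).** If the after-trees of `Alg` (minus their
roots) cannot be partitioned into a bounded number of monotone sets, then `Alg` does not
satisfy the access lemma with the SOL potential: for every constant `C` there are an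
access and a positive weight function violating the inequality. -/
theorem necessity_monotone (Alg : BTree → ℕ → BTree → Prop)
    (hvalid : ∀ T s T', Alg T s T' → IsAccess T s T')
    (hnodecomp : ∀ k : ℕ, ∃ T s T', Alg T s T' ∧ ¬ MonotoneDecomp T s T' k) :
    ∀ C : ℝ, ∃ T s T', Alg T s T' ∧ ∃ w : ℕ → ℝ, (∀ i ∈ keys T, 0 < w i) ∧
      phiAll w T - phiAll w T' + C * (1 + Real.logb 2 (wsum w (keys T) / w s)) <
        ((pathSet T s).card : ℝ) := by
  intro C
  obtain ⟨K, hK⟩ := exists_nat_ge (|C| + 2)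
  obtain ⟨T, s, T', hAlg, hdec⟩ := hnodecomp (K + K)
  refine ⟨T, s, T', hAlg, ?_⟩
  by_contra hno
  refine hdec (monotoneDecomp_of_depth_lt (fun b hb hsb => ?_) fun b hb hbs => ?_)
  · by_contra! hd
    exact hno (exists_weight_of_rightDepth (hvalid _ _ _ hAlg) C hb hsb
      (hK.trans (Nat.cast_le.mpr hd)))
  · by_contra! hd
    exact hno (exists_weight_of_leftDepth (hvalid _ _ _ hAlg) C hb hbs
      (hK.trans (Nat.cast_le.mpr hd)))
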